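/- There exist a real constant D₂ and constants C > 0, θ₀ > 0 such that for all 0 < θ < θ₀, | (1/cos θ) ∫_{θ/3}^{3θ} cot φ · cos((φ+θ)/4) dφ − 2 log 3 − D₂ θ² | ≤ C θ⁴. -/

import Mathlib

open Real intervalIntegral

/-- First-order Laurent bound for the cotangent near `0`, cleared of denominators. -/
lemma abs_mul_cos_sub_sin_mul_le {x : ℝ} (hx : 0 < x) :
    |x * cos x - sin x * (1 - x ^ 2 / 3)| ≤ x ^ 5 := by
  have hderiv : ∀ y ∈ Set.Icc 0 x,
      HasDerivWithinAt (fun y => y * cos y - sin y * (1 - y ^ 2 / 3))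
        (y / 3 * (y * cos y - sin y)) (Set.Icc 0 x) y := by
    intro y _
    refine HasDerivAt.hasDerivWithinAt ?_
    refine HasDerivAt.congr_deriv (((hasDerivAt_id y).mul (hasDerivAt_cos y)).sub
      ((hasDerivAt_sin y).mul ((((hasDerivAt_id y).pow 2).div_const 3).const_sub 1))) ?_
    simp only [id]
    push_cast
    ring
  have hbound : ∀ y ∈ Set.Ico 0 x, ‖y / 3 * (y * cos y - sin y)‖ ≤ x ^ 4 := by
    rintro y ⟨hy0, hyx⟩
    rcases hy0.eq_or_lt with rfl | hy
    · simp only [zero_div, zero_mul, norm_zero]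
      positivity
    have hsin := sin_gt_sub_cube hy
    have hsin' := sin_lt hy
    have hcos := one_sub_sq_div_two_le_cos (x := y)
    have hcos' := cos_le_one y
    have h3 : |y * cos y - sin y| ≤ y ^ 3 := by
      have := pow_pos hy 3
      rw [abs_le]
      constructor <;> nlinarith
    rw [norm_mul, norm_eq_abs, norm_eq_abs, abs_of_pos (by positivity)]
    calc y / 3 * |y * cos y - sin y| ≤ y * y ^ 3 := by gcongr; linarith
      _ = y ^ 4 := by ring
      _ ≤ x ^ 4 := by gcongr
  have h := norm_image_sub_le_of_norm_deriv_le_segment' hderiv hbound x ⟨hx.le, le_rfl⟩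
  simp only [norm_eq_abs, zero_mul, sin_zero, sub_zero] at h
  calc _ ≤ _ := h
    _ = x ^ 5 := by ring

lemma three_quarters_mul_le_sin {x : ℝ} (hx : 0 < x) (hx1 : x ≤ 1) : 3 / 4 * x ≤ sin x := by
  have := sin_gt_sub_cube hx
  have : x ^ 3 ≤ x := pow_le_of_le_one hx.le hx1 (by norm_num)
  linarith

lemma abs_cot_sub_le {x : ℝ} (hx : 0 < x) (hx1 : x ≤ 1) :
    |cot x - (1 / x - x / 3)| ≤ 4 / 3 * x ^ 3 := by
  have hs := three_quarters_mul_le_sin hx hx1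
  have hs0 : 0 < sin x := by linarith
  have heq : cot x - (1 / x - x / 3) =
      (x * cos x - sin x * (1 - x ^ 2 / 3)) / (x * sin x) := by
    rw [cot_eq_cos_div_sin]
    field_simp
  rw [heq, abs_div, abs_of_pos (mul_pos hx hs0), div_le_iff₀ (mul_pos hx hs0)]
  calc _ ≤ x ^ 5 := abs_mul_cos_sub_sin_mul_le hx
    _ = 4 / 3 * x ^ 3 * (x * (3 / 4 * x)) := by ring
    _ ≤ _ := by gcongr

lemma abs_cot_le {x : ℝ} (hx : 0 < x) (hx1 : x ≤ 1) : |cot x| ≤ 4 / (3 * x) := by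
  have hs := three_quarters_mul_le_sin hx hx1
  have hs0 : 0 < sin x := by linarith
  rw [cot_eq_cos_div_sin, abs_div, abs_of_pos hs0, div_le_div_iff₀ hs0 (by positivity)]
  nlinarith [abs_cos_le_one x]

lemma abs_integrand_sub_le {θ φ : ℝ} (hθ : 0 < θ) (hθ1 : θ < 1 / 3)
    (h₁ : θ / 3 ≤ φ) (h₂ : φ ≤ 3 * θ) :
    |cot φ * cos ((φ + θ) / 4) - (1 / φ - φ / 3 - (φ + θ) ^ 2 / (32 * φ))| ≤
      38 * θ ^ 3 := by
  have hφ : 0 < φ := by linarith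
  have hφ1 : φ ≤ 1 := by linarith
  have hcos := cos_bound (x := (φ + θ) / 4) (by rw [abs_of_pos (by linarith)]; linarith)
  set h := cos ((φ + θ) / 4) - (1 - ((φ + θ) / 4) ^ 2 / 2) with hh
  have hh_le : |h| ≤ θ ^ 4 * (5 / 96) := by
    refine hcos.trans ?_
    rw [abs_of_pos (by linarith)]
    gcongr
    linarith
  have hcot : |cot φ| ≤ 4 / θ := by
    refine (abs_cot_le hφ hφ1).trans ?_
    gcongr
    linarith
  have hg : |cot φ - (1 / φ - φ / 3)| ≤ 36 * θ ^ 3 := by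
    calc _ ≤ _ := abs_cot_sub_le hφ hφ1
      _ ≤ 4 / 3 * (3 * θ) ^ 3 := by gcongr
      _ = _ := by ring
  have hB : |1 - ((φ + θ) / 4) ^ 2 / 2| ≤ 1 := by
    rw [abs_le]
    constructor <;> nlinarith
  have heq : cot φ * cos ((φ + θ) / 4) - (1 / φ - φ / 3 - (φ + θ) ^ 2 / (32 * φ)) =
      cot φ * h + (cot φ - (1 / φ - φ / 3)) * (1 - ((φ + θ) / 4) ^ 2 / 2) +
        φ * (φ + θ) ^ 2 / 96 := by
    rw [hh]
    field_simp
    ring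
  have e₁ : |cot φ * h| ≤ θ ^ 3 := by
    rw [abs_mul]
    calc _ ≤ 4 / θ * (θ ^ 4 * (5 / 96)) := by gcongr
      _ = 5 / 24 * θ ^ 3 := by field_simp; ring
      _ ≤ _ := by nlinarith [pow_pos hθ 3]
  have e₂ : |(cot φ - (1 / φ - φ / 3)) * (1 - ((φ + θ) / 4) ^ 2 / 2)| ≤ 36 * θ ^ 3 := by
    rw [abs_mul]
    calc _ ≤ 36 * θ ^ 3 * 1 := by gcongr
      _ = _ := mul_one _
  have e₃ : |φ * (φ + θ) ^ 2 / 96| ≤ θ ^ 3 := by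
    rw [abs_of_pos (by positivity)]
    calc _ ≤ 3 * θ * (3 * θ + θ) ^ 2 / 96 := by gcongr
      _ = 1 / 2 * θ ^ 3 := by ring
      _ ≤ _ := by nlinarith [pow_pos hθ 3]
  rw [heq]
  refine (abs_add_three _ _ _).trans ?_
  linarith

lemma continuousOn_laurent_part {θ : ℝ} (hθ : 0 < θ) :
    ContinuousOn (fun φ : ℝ => 1 / φ - φ / 3 - (φ + θ) ^ 2 / (32 * φ))
      (Set.Icc (θ / 3) (3 * θ)) := by
  have h0 : ∀ φ ∈ Set.Icc (θ / 3) (3 * θ), φ ≠ 0 := fun φ hφ => by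
    have := hφ.1
    intro h
    linarith
  have h0' : ∀ φ ∈ Set.Icc (θ / 3) (3 * θ), 32 * φ ≠ 0 := fun φ hφ =>
    mul_ne_zero (by norm_num) (h0 φ hφ)
  fun_prop (disch := assumption)

lemma integral_laurent_part {θ : ℝ} (hθ : 0 < θ) :
    ∫ φ in (θ / 3)..(3 * θ), (1 / φ - φ / 3 - (φ + θ) ^ 2 / (32 * φ)) =
      2 * log 3 + (-(40 / 27) - (88 / 9 + 2 * log 3) / 32) * θ ^ 2 := by
  have hle : θ / 3 ≤ 3 * θ := by linarith
  have hderiv : ∀ φ ∈ Set.uIcc (θ / 3) (3 * θ),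
      HasDerivAt
        (fun φ => log φ - φ ^ 2 / 6 - (φ ^ 2 / 2 + 2 * θ * φ + θ ^ 2 * log φ) / 32)
        (1 / φ - φ / 3 - (φ + θ) ^ 2 / (32 * φ)) φ := by
    intro φ hφ
    rw [Set.uIcc_of_le hle] at hφ
    have hφ0 : φ ≠ 0 := by
      have := hφ.1
      intro h
      linarith
    have hsq := (hasDerivAt_id φ).pow 2
    refine HasDerivAt.congr_deriv (((hasDerivAt_log hφ0).sub (hsq.div_const 6)).sub
      ((((hsq.div_const 2).add ((hasDerivAt_id φ).const_mul (2 * θ))).add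
        ((hasDerivAt_log hφ0).const_mul (θ ^ 2))).div_const 32)) ?_
    simp only [id]
    push_cast
    field_simp
    ring
  rw [integral_eq_sub_of_hasDerivAt hderiv
    (ContinuousOn.intervalIntegrable_of_Icc hle (continuousOn_laurent_part hθ)),
    log_div hθ.ne' (by norm_num), log_mul (by norm_num) hθ.ne']
  ring

lemma abs_integral_sub_le {θ : ℝ} (hθ : 0 < θ) (hθ1 : θ < 1 / 3) :
    |(∫ φ in (θ / 3)..(3 * θ), cot φ * cos ((φ + θ) / 4)) -
      (2 * log 3 + (-(40 / 27) - (88 / 9 + 2 * log 3) / 32) * θ ^ 2)| ≤ 102 * θ ^ 4 := by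
  have hle : θ / 3 ≤ 3 * θ := by linarith
  have hint : IntervalIntegrable (fun φ => cot φ * cos ((φ + θ) / 4)) MeasureTheory.volume
      (θ / 3) (3 * θ) := by
    refine ContinuousOn.intervalIntegrable_of_Icc hle ?_
    have hs : ∀ φ ∈ Set.Icc (θ / 3) (3 * θ), sin φ ≠ 0 := fun φ hφ => by
      have h1 := hφ.1
      have h2 := hφ.2
      have := three_quarters_mul_le_sin (x := φ) (by linarith) (by linarith)
      intro h
      linarith
    simp only [cot_eq_cos_div_sin]
    fun_prop (disch := assumption)
  rw [← integral_laurent_part hθ, ← integral_sub hint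
    (ContinuousOn.intervalIntegrable_of_Icc hle (continuousOn_laurent_part hθ))]
  have h := norm_integral_le_of_norm_le_const (a := θ / 3) (b := 3 * θ) (C := 38 * θ ^ 3)
    (f := fun φ => cot φ * cos ((φ + θ) / 4) - (1 / φ - φ / 3 - (φ + θ) ^ 2 / (32 * φ)))
    (fun φ hφ => by
      rw [Set.uIoc_of_le hle] at hφ
      exact abs_integrand_sub_le hθ hθ1 hφ.1.le hφ.2)
  rw [norm_eq_abs, abs_of_nonneg (sub_nonneg.2 hle)] at h
  refine h.trans ?_
  nlinarith [pow_pos hθ 4]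

lemma half_le_cos {θ : ℝ} (h : |θ| ≤ 1) : 1 / 2 ≤ cos θ := by
  have := one_sub_sq_div_two_le_cos (x := θ)
  have := (sq_le_one_iff_abs_le_one θ).2 h
  linarith

lemma abs_one_div_cos_sub_le {θ : ℝ} (h : |θ| ≤ 1) :
    |1 / cos θ - (1 + θ ^ 2 / 2)| ≤ 2 * θ ^ 4 := by
  have hc := half_le_cos h
  have hc0 : 0 < cos θ := by linarith
  have hb := cos_bound h
  have h2 := (sq_le_one_iff_abs_le_one θ).2 h
  have h4 : |θ| ^ 4 = θ ^ 4 := Even.pow_abs (by decide) θ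
  have h4' : 0 ≤ θ ^ 4 := by positivity
  rw [h4] at hb
  have heq : 1 / cos θ - (1 + θ ^ 2 / 2) =
      (θ ^ 4 / 4 - (cos θ - (1 - θ ^ 2 / 2)) * (1 + θ ^ 2 / 2)) / cos θ := by
    field_simp
    ring
  rw [heq, abs_div, abs_of_pos hc0, div_le_iff₀ hc0]
  have hp : |(cos θ - (1 - θ ^ 2 / 2)) * (1 + θ ^ 2 / 2)| ≤ θ ^ 4 * (5 / 96) * 2 := by
    rw [abs_mul, abs_of_pos (by positivity : 0 < 1 + θ ^ 2 / 2)]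
    gcongr
    linarith
  have hq := abs_sub (θ ^ 4 / 4) ((cos θ - (1 - θ ^ 2 / 2)) * (1 + θ ^ 2 / 2))
  rw [abs_of_nonneg (by positivity : 0 ≤ θ ^ 4 / 4)] at hq
  nlinarith

/-- Second-order asymptotic expansion, as `θ → 0⁺`, of the trigonometric
integral `(1/cos θ) ∫_{θ/3}^{3θ} cot φ cos((φ+θ)/4) dφ = 2 log 3 + D₂ θ² + O(θ⁴)`. -/
theorem semicircle_integral_expansion_two :
    ∃ D₂ : ℝ, ∃ C > (0 : ℝ), ∃ θ₀ > (0 : ℝ), ∀ θ : ℝ, 0 < θ → θ < θ₀ →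
      |1 / Real.cos θ * (∫ φ in (θ / 3)..(3 * θ), Real.cot φ * Real.cos ((φ + θ) / 4)) -
        2 * Real.log 3 - D₂ * θ ^ 2| ≤ C * θ ^ 4 := by
  set a : ℝ := -(40 / 27) - (88 / 9 + 2 * log 3) / 32 with ha
  have hL : 0 < log 3 := log_pos (by norm_num)
  refine ⟨a + log 3, 2 * (2 * log 3 + |a|) + 204 + |a| / 2, by positivity, 1 / 3,
    by norm_num, fun θ hθ hθ1 => ?_⟩
  have hE := abs_integral_sub_le hθ hθ1
  rw [← ha] at hE
  set I := ∫ φ in (θ / 3)..(3 * θ), cot φ * cos ((φ + θ) / 4)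
  have habs : |θ| ≤ 1 := by rw [abs_of_pos hθ]; linarith
  have hr := abs_one_div_cos_sub_le habs
  have hc := half_le_cos habs
  have hs : |1 / cos θ| ≤ 2 := by
    rw [abs_of_pos (by positivity), div_le_iff₀ (by linarith)]
    linarith
  have hm : |2 * log 3 + a * θ ^ 2| ≤ 2 * log 3 + |a| := by
    refine (abs_add_le _ _).trans ?_
    rw [abs_of_pos (by positivity : 0 < 2 * log 3), abs_mul,
      abs_of_pos (by positivity : 0 < θ ^ 2)]
    have : θ ^ 2 ≤ 1 := (sq_le_one_iff_abs_le_one θ).2 habs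
    nlinarith [abs_nonneg a]
  have heq : 1 / cos θ * I - 2 * log 3 - (a + log 3) * θ ^ 2 =
      (1 / cos θ - (1 + θ ^ 2 / 2)) * (2 * log 3 + a * θ ^ 2) +
        1 / cos θ * (I - (2 * log 3 + a * θ ^ 2)) + a / 2 * θ ^ 4 := by
    ring
  rw [heq]
  refine (abs_add_three _ _ _).trans ?_
  rw [abs_mul, abs_mul, abs_mul (a / 2), abs_div a, abs_of_pos (by positivity : 0 < θ ^ 4),
    abs_two]
  calc _ ≤ 2 * θ ^ 4 * (2 * log 3 + |a|) + 2 * (102 * θ ^ 4) + |a| / 2 * θ ^ 4 := by gcongr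
    _ = _ := by ring
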